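/- For every prior P(S,Y) and every ε≥0, any ε-IP Blackwell optimal information structure P(S,Y,T) has the inferential-privacy constraint binding on T̃: for every t∈T̃, H_t = e^ε·L_t, and P(T=t|S=s) ∈ {L_t, H_t} for every s∈𝒮. -/

import Mathlib

open Real
open scoped Classical

noncomputable section

namespace IPPaper

variable {S T : Type} [Fintype S] [Fintype T]

/-- Marginal probability of the secret `S`. -/
def pS (P : S → Bool → T → ℝ) (s : S) : ℝ := ∑ y, ∑ t, P s y t

/-- Marginal probability of the signal `T`. -/
def pT (P : S → Bool → T → ℝ) (t : T) : ℝ := ∑ s, ∑ y, P s y t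

/-- Joint marginal on `(S,T)`. -/
def pST (P : S → Bool → T → ℝ) (s : S) (t : T) : ℝ := ∑ y, P s y t

/-- Joint marginal on `(Y,T)`. -/
def pYT (P : S → Bool → T → ℝ) (y : Bool) (t : T) : ℝ := ∑ s, P s y t

/-- Joint marginal on `(S,Y)`. -/
def pSY (P : S → Bool → T → ℝ) (s : S) (y : Bool) : ℝ := ∑ t, P s y t

/-- An information structure: nonnegative, sums to one, every secret has positive
probability. -/
def InfoStructure (P : S → Bool → T → ℝ) : Prop :=
  (∀ s y t, 0 ≤ P s y t) ∧ (∑ s, ∑ y, ∑ t, P s y t) = 1 ∧ ∀ s, 0 < pS P s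

/-- Conditional probability `P(T = t | S = s)`. -/
def condTS (P : S → Bool → T → ℝ) (t : T) (s : S) : ℝ := pST P s t / pS P s

/-- Conditional probability `P(S = s | T = t)`. -/
def condST (P : S → Bool → T → ℝ) (s : S) (t : T) : ℝ := pST P s t / pT P t

/-- Posterior `P(Y = 1 | T = t)`. -/
def postYT (P : S → Bool → T → ℝ) (t : T) : ℝ := pYT P true t / pT P t

/-- Posterior `P(Y = 1 | S = s, T = t)`. -/
def postYST (P : S → Bool → T → ℝ) (s : S) (t : T) : ℝ := P s true t / pST P s t

/-- Prior conditional `P(Y = 1 | S = s)`. -/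
def qS (P : S → Bool → T → ℝ) (s : S) : ℝ := pSY P s true / pS P s

/-- `ε`-inferential privacy. -/
def IsIP (ε : ℝ) (P : S → Bool → T → ℝ) : Prop :=
  ∀ s₁ s₂ t, condTS P t s₁ ≤ Real.exp ε * condTS P t s₂

/-- Blackwell dominance via a row-stochastic garbling kernel. -/
def BlackwellDom {T₁ T₂ : Type} [Fintype T₁] [Fintype T₂]
    (Q₁ : Bool → T₁ → ℝ) (Q₂ : Bool → T₂ → ℝ) : Prop :=
  ∃ G : T₁ → T₂ → ℝ, (∀ a b, 0 ≤ G a b) ∧ (∀ a, ∑ b, G a b = 1) ∧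
    ∀ y b, Q₂ y b = ∑ a, Q₁ y a * G a b

/-- `ε`-IP Blackwell optimality: no ε-IP information structure with the same
marginal on `(S,Y)` (over any finite signal set) strictly Blackwell dominates it. -/
def BlackwellOptimal (ε : ℝ) (P : S → Bool → T → ℝ) : Prop :=
  InfoStructure P ∧ IsIP ε P ∧
  ¬ ∃ (n : ℕ) (P' : S → Bool → Fin n → ℝ),
      InfoStructure P' ∧ IsIP ε P' ∧ (∀ s y, pSY P' s y = pSY P s y) ∧
      BlackwellDom (pYT P') (pYT P) ∧ ¬ BlackwellDom (pYT P) (pYT P')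

/-- Membership in `T̃`: signals with positive probability and nondegenerate posterior. -/
def inTildeT (P : S → Bool → T → ℝ) (t : T) : Prop :=
  0 < pT P t ∧ postYT P t ≠ 0 ∧ postYT P t ≠ 1

/-- `L_t = min_s P(T=t|S=s)`. -/
def Lval [Nonempty S] (P : S → Bool → T → ℝ) (t : T) : ℝ :=
  Finset.univ.inf' Finset.univ_nonempty (fun s => condTS P t s)

/-- `H_t = max_s P(T=t|S=s)`. -/
def Hval [Nonempty S] (P : S → Bool → T → ℝ) (t : T) : ℝ :=
  Finset.univ.sup' Finset.univ_nonempty (fun s => condTS P t s)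

/-- Expected utility `Σ_{t : P(T=t)>0} P(T=t)·u(P(Y=1|T=t))`. -/
def EU (P : S → Bool → T → ℝ) (u : ℝ → ℝ) : ℝ :=
  ∑ t ∈ Finset.univ.filter (fun t => 0 < pT P t), pT P t * u (postYT P t)

end IPPaper

namespace IPPaper

section Splitting

variable {S T : Type} [Fintype S] [Fintype T]

/-- The homogeneous convex function `(x₁, x₀) ↦ x₁ ^ 2 / (x₁ + x₀)` summed over all signals. -/
def quadInfo (Q : Bool → T → ℝ) : ℝ := ∑ t, Q true t ^ 2 / (Q true t + Q false t)

theorem sq_eq_sq_div_mul_add {x y : ℝ} (hx : 0 ≤ x) (hy : 0 ≤ y) :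
    x ^ 2 = x ^ 2 / (x + y) * (x + y) := by
  rcases eq_or_ne (x + y) 0 with h | h
  · have : x = 0 := by linarith
    simp [this]
  · field_simp

theorem quadInfo_le_of_blackwellDom {T₁ T₂ : Type} [Fintype T₁] [Fintype T₂]
    {Q₁ : Bool → T₁ → ℝ} {Q₂ : Bool → T₂ → ℝ} (hQ : ∀ y t, 0 ≤ Q₁ y t)
    (h : BlackwellDom Q₁ Q₂) : quadInfo Q₂ ≤ quadInfo Q₁ := by
  obtain ⟨G, hG, hG1, hGQ⟩ := h
  have hterm : ∀ b, Q₂ true b ^ 2 / (Q₂ true b + Q₂ false b) ≤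
      ∑ a, Q₁ true a ^ 2 / (Q₁ true a + Q₁ false a) * G a b := by
    intro b
    have hf : ∀ a, 0 ≤ Q₁ true a ^ 2 / (Q₁ true a + Q₁ false a) * G a b := fun a =>
      mul_nonneg (div_nonneg (sq_nonneg _) (add_nonneg (hQ _ _) (hQ _ _))) (hG a b)
    have hg : ∀ a, 0 ≤ (Q₁ true a + Q₁ false a) * G a b := fun a =>
      mul_nonneg (add_nonneg (hQ _ _) (hQ _ _)) (hG a b)
    have hsum : Q₂ true b + Q₂ false b = ∑ a, (Q₁ true a + Q₁ false a) * G a b := by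
      rw [hGQ, hGQ, ← Finset.sum_add_distrib]
      simp only [add_mul]
    rw [hsum, hGQ]
    refine div_le_of_le_mul₀ (Finset.sum_nonneg fun a _ => hg a)
      (Finset.sum_nonneg fun a _ => hf a) ?_
    refine Finset.sum_sq_le_sum_mul_sum_of_sq_le_mul _ (fun a _ => hf a) (fun a _ => hg a) ?_
    intro a _
    refine le_of_eq ?_
    linear_combination G a b ^ 2 * sq_eq_sq_div_mul_add (hQ true a) (hQ false a)
  calc quadInfo Q₂ ≤ ∑ b, ∑ a, Q₁ true a ^ 2 / (Q₁ true a + Q₁ false a) * G a b :=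
        Finset.sum_le_sum fun b _ => hterm b
    _ = quadInfo Q₁ := by
        rw [Finset.sum_comm]
        simp only [← Finset.mul_sum, hG1, mul_one, quadInfo]

theorem sq_div_add_le {a₁ a₀ b₁ b₀ : ℝ} (ha₁ : 0 ≤ a₁) (ha₀ : 0 ≤ a₀) (hb₁ : 0 ≤ b₁)
    (hb₀ : 0 ≤ b₀) :
    (a₁ + b₁) ^ 2 / (a₁ + b₁ + (a₀ + b₀)) ≤ a₁ ^ 2 / (a₁ + a₀) + b₁ ^ 2 / (b₁ + b₀) := by
  have hA := sq_eq_sq_div_mul_add ha₁ ha₀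
  have hB := sq_eq_sq_div_mul_add hb₁ hb₀
  have hA0 : 0 ≤ a₁ ^ 2 / (a₁ + a₀) := by positivity
  have hB0 : 0 ≤ b₁ ^ 2 / (b₁ + b₀) := by positivity
  refine div_le_of_le_mul₀ (by positivity) (by positivity) ?_
  have := Finset.sum_sq_le_sum_mul_sum_of_sq_le_mul (Finset.univ : Finset Bool)
    (r := fun i => cond i a₁ b₁)
    (f := fun i => cond i (a₁ ^ 2 / (a₁ + a₀)) (b₁ ^ 2 / (b₁ + b₀)))
    (g := fun i => cond i (a₁ + a₀) (b₁ + b₀))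
    (by rintro (_ | _) _ <;> assumption)
    (by rintro (_ | _) _ <;> simp only [cond_true, cond_false] <;> positivity)
    (by rintro (_ | _) _; exacts [hB.le, hA.le])
  simp only [Fintype.sum_bool, cond_true, cond_false] at this
  linarith

theorem proportional_of_sq_div_add_eq {a₁ a₀ b₁ b₀ : ℝ} (ha₁ : 0 ≤ a₁) (ha₀ : 0 ≤ a₀)
    (hb₁ : 0 ≤ b₁) (hb₀ : 0 ≤ b₀)
    (h : (a₁ + b₁) ^ 2 / (a₁ + b₁ + (a₀ + b₀)) = a₁ ^ 2 / (a₁ + a₀) + b₁ ^ 2 / (b₁ + b₀)) :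
    a₁ * (a₀ + b₀) = a₀ * (a₁ + b₁) := by
  rcases (add_nonneg ha₁ ha₀).eq_or_lt with hA | hA
  · have h1 : a₁ = 0 := by linarith
    have h0 : a₀ = 0 := by linarith
    simp [h1, h0]
  rcases (add_nonneg hb₁ hb₀).eq_or_lt with hB | hB
  · have h1 : b₁ = 0 := by linarith
    have h0 : b₀ = 0 := by linarith
    simp [h1, h0, mul_comm]
  have hAB : 0 < a₁ + b₁ + (a₀ + b₀) := by linarith
  rw [div_add_div _ _ hA.ne' hB.ne', div_eq_div_iff hAB.ne' (mul_pos hA hB).ne'] at h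
  have : (a₁ * b₀ - a₀ * b₁) ^ 2 = 0 := by linear_combination -h
  have := pow_eq_zero_iff two_ne_zero |>.1 this
  linear_combination this

theorem BlackwellOptimal.blackwellDom {ε : ℝ} {P : S → Bool → T → ℝ}
    (hopt : BlackwellOptimal ε P) {U : Type} [Fintype U] {P' : S → Bool → U → ℝ}
    (hP' : InfoStructure P') (hIP : IsIP ε P') (hSY : ∀ s y, pSY P' s y = pSY P s y)
    (hdom : BlackwellDom (pYT P') (pYT P)) : BlackwellDom (pYT P) (pYT P') := by
  by_contra hnot
  let e := (Fintype.equivFin U).symm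
  have hpS : ∀ s, pS (fun s y i => P' s y (e i)) s = pS P' s := fun s =>
    Finset.sum_congr rfl fun y _ => e.sum_comp (P' s y)
  refine hopt.2.2 ⟨Fintype.card U, fun s y i => P' s y (e i), ⟨fun s y i => hP'.1 s y _, ?_, ?_⟩,
    ?_, fun s y => (e.sum_comp (P' s y)).trans (hSY s y), ?_, ?_⟩
  · rw [← hP'.2.1]
    exact Finset.sum_congr rfl fun s _ => hpS s
  · exact fun s => (hP'.2.2 s).trans_eq (hpS s).symm
  · intro s₁ s₂ i
    have := hIP s₁ s₂ (e i)
    unfold condTS at this ⊢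
    rwa [hpS, hpS]
  · obtain ⟨G, hG, hG1, hGQ⟩ := hdom
    refine ⟨fun i b => G (e i) b, fun i b => hG _ _, fun i => hG1 _, fun y b => ?_⟩
    rw [hGQ]
    exact (e.sum_comp fun a => pYT P' y a * G a b).symm
  · rintro ⟨G, hG, hG1, hGQ⟩
    refine hnot ⟨fun a u => G a (e.symm u), fun a u => hG _ _, fun a => ?_, fun y u => ?_⟩
    · rw [← hG1 a]
      exact e.symm.sum_comp (G a)
    · rw [← hGQ]
      simp [pYT]

/-- If every signal of a Blackwell optimal structure `P` is split into two signals, carrying `A` and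
`P - A`, without violating privacy, then the posteriors of `Y` are unchanged. -/
theorem BlackwellOptimal.proportional_of_split {ε : ℝ} {P : S → Bool → T → ℝ}
    (hopt : BlackwellOptimal ε P) (A : S → Bool → T → ℝ)
    (hA : ∀ s y t, 0 ≤ A s y t) (hAP : ∀ s y t, A s y t ≤ P s y t)
    (hIP : ∀ s₁ s₂ t, pST A s₁ t / pS P s₁ ≤ Real.exp ε * (pST A s₂ t / pS P s₂))
    (hIP' : ∀ s₁ s₂ t, (pST P s₁ t - pST A s₁ t) / pS P s₁ ≤
      Real.exp ε * ((pST P s₂ t - pST A s₂ t) / pS P s₂)) (t : T) :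
    pYT A true t * pYT P false t = pYT A false t * pYT P true t := by
  let P' : S → Bool → T × Bool → ℝ := fun s y u => cond u.2 (A s y u.1) (P s y u.1 - A s y u.1)
  have hP'0 : ∀ s y u, 0 ≤ P' s y u := by
    rintro s y ⟨t, _ | _⟩
    · exact sub_nonneg.2 (hAP s y t)
    · exact hA s y t
  have hSY : ∀ s y, pSY P' s y = pSY P s y := fun s y => by
    simp [pSY, P', Fintype.sum_prod_type]
  have hpS : ∀ s, pS P' s = pS P s := fun s => Finset.sum_congr rfl fun y _ => hSY s y
  have hYT : ∀ y t, pYT P' y (t, false) = pYT P y t - pYT A y t := fun y t => by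
    simp [pYT, P']
  have hdom : BlackwellDom (pYT P') (pYT P) := by
    refine ⟨fun u b => if u.1 = b then 1 else 0, fun u b => by positivity, fun u => by simp,
      fun y b => ?_⟩
    rw [Fintype.sum_prod_type, Finset.sum_eq_single b]
    · simp only [if_true, mul_one, Fintype.sum_bool, hYT]
      simp [pYT, P']
    · intro a _ hab
      simp [hab]
    · simp
  have hInfo : InfoStructure P' := by
    refine ⟨hP'0, ?_, fun s => (hopt.1.2.2 s).trans_eq (hpS s).symm⟩
    rw [← hopt.1.2.1]
    exact Finset.sum_congr rfl fun s _ => hpS s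
  have hIPP' : IsIP ε P' := by
    rintro s₁ s₂ ⟨t, _ | _⟩
    · have := hIP' s₁ s₂ t
      simpa [condTS, hpS, pST, P', Finset.sum_sub_distrib, add_sub_add_comm] using this
    · have := hIP s₁ s₂ t
      simpa [condTS, hpS, pST, P'] using this
  have hle := quadInfo_le_of_blackwellDom
    (fun y t => Finset.sum_nonneg fun s _ => hopt.1.1 s y t)
    (hopt.blackwellDom hInfo hIPP' hSY hdom)
  have hA0 : ∀ y t, 0 ≤ pYT A y t := fun y t => Finset.sum_nonneg fun s _ => hA s y t
  have hB0 : ∀ y t, 0 ≤ pYT P y t - pYT A y t := fun y t =>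
    sub_nonneg.2 (Finset.sum_le_sum fun s _ => hAP s y t)
  have hterm := fun t => sq_div_add_le (hA0 true t) (hA0 false t) (hB0 true t) (hB0 false t)
  have hsum : quadInfo (pYT P') = ∑ t, (pYT A true t ^ 2 / (pYT A true t + pYT A false t) +
      (pYT P true t - pYT A true t) ^ 2 /
        (pYT P true t - pYT A true t + (pYT P false t - pYT A false t))) := by
    simp only [quadInfo, Fintype.sum_prod_type, Fintype.sum_bool, hYT]
    rfl
  have heq := (Finset.sum_eq_sum_iff_of_le fun t (_ : t ∈ Finset.univ) => hterm t).1
    (le_antisymm (Finset.sum_le_sum fun t _ => hterm t) (by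
      rw [← hsum]
      simpa only [add_sub_cancel] using! hle))
  have := proportional_of_sq_div_add_eq (hA0 true t) (hA0 false t) (hB0 true t) (hB0 false t)
    (heq t (Finset.mem_univ t))
  simpa only [add_sub_cancel] using this

theorem pST_eq_add {S T : Type} (P : S → Bool → T → ℝ) (s : S) (t : T) :
    pST P s t = P s true t + P s false t := by
  simp [pST]

theorem pT_eq_add {S T : Type} [Fintype S] (P : S → Bool → T → ℝ) (t : T) :
    pT P t = pYT P true t + pYT P false t := by
  simp [pT, pYT, Finset.sum_add_distrib]

theorem InfoStructure.le_one {P : S → Bool → T → ℝ} (hP : InfoStructure P) (s : S) (y : Bool)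
    (t : T) : P s y t ≤ 1 := by
  have h0 := hP.1
  calc P s y t ≤ ∑ t, P s y t :=
        Finset.single_le_sum (f := P s y) (fun t _ => h0 s y t) (Finset.mem_univ t)
    _ ≤ ∑ y, ∑ t, P s y t :=
        Finset.single_le_sum (f := fun y => ∑ t, P s y t)
          (fun y _ => Finset.sum_nonneg fun t _ => h0 s y t) (Finset.mem_univ y)
    _ ≤ ∑ s, ∑ y, ∑ t, P s y t :=
        Finset.single_le_sum (f := fun s => ∑ y, ∑ t, P s y t)
          (fun s _ => Finset.sum_nonneg fun y _ => Finset.sum_nonneg fun t _ => h0 s y t)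
          (Finset.mem_univ s)
    _ = 1 := hP.2.1

/-- In a Blackwell optimal structure, `Y` is determined by the secret and the signal. -/
theorem BlackwellOptimal.mul_eq_zero {ε : ℝ} {P : S → Bool → T → ℝ}
    (hopt : BlackwellOptimal ε P) {t : T} (ht : 0 < pT P t) (s : S) :
    P s true t * P s false t = 0 := by
  have h0 := hopt.1.1
  have h1 := hopt.1.le_one
  let A : S → Bool → T → ℝ := fun s y t =>
    cond y (P s true t / 2 + P s true t * P s false t / 2)
      (P s false t / 2 - P s true t * P s false t / 2)
  have hST : ∀ s t, pST A s t = pST P s t / 2 := fun s t => by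
    simp only [pST_eq_add, A, cond_true, cond_false]
    ring
  have hhalf : ∀ s₁ s₂ t, pST P s₁ t / 2 / pS P s₁ ≤
      Real.exp ε * (pST P s₂ t / 2 / pS P s₂) := fun s₁ s₂ t => by
    have := hopt.2.1 s₁ s₂ t
    unfold condTS at this
    rw [div_right_comm, div_right_comm (pST P s₂ t)]
    linarith
  have key := hopt.proportional_of_split A
    (by
      rintro s (_ | _) t
      · simp only [A, cond_false]
        nlinarith [mul_nonneg (h0 s false t) (sub_nonneg.2 (h1 s true t))]
      · simp only [A, cond_true]
        nlinarith [mul_nonneg (h0 s true t) (h0 s false t), h0 s true t])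
    (by
      rintro s (_ | _) t
      · simp only [A, cond_false]
        nlinarith [mul_nonneg (h0 s true t) (h0 s false t), h0 s false t]
      · simp only [A, cond_true]
        nlinarith [mul_nonneg (h0 s true t) (sub_nonneg.2 (h1 s false t))])
    (fun s₁ s₂ t => by simpa only [hST] using hhalf s₁ s₂ t)
    (fun s₁ s₂ t => by simpa only [hST, sub_half] using hhalf s₁ s₂ t) t
  have hA₁ : pYT A true t = pYT P true t / 2 + (∑ s, P s true t * P s false t) / 2 := by
    simp [pYT, A, Finset.sum_add_distrib, Finset.sum_div]
  have hA₀ : pYT A false t = pYT P false t / 2 - (∑ s, P s true t * P s false t) / 2 := by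
    simp [pYT, A, Finset.sum_sub_distrib, Finset.sum_div]
  rw [hA₁, hA₀] at key
  have hX : (∑ s, P s true t * P s false t) * pT P t = 0 := by
    rw [pT_eq_add]
    linear_combination 2 * key
  have hX := (_root_.mul_eq_zero.1 hX).resolve_right ht.ne'
  exact (Finset.sum_eq_zero_iff_of_nonneg fun s _ => mul_nonneg (h0 s true t) (h0 s false t)).1 hX
    s (Finset.mem_univ s)

theorem inTildeT.pYT_ne_zero {S T : Type} [Fintype S] {P : S → Bool → T → ℝ} {t : T}
    (ht : inTildeT P t) (y : Bool) :
    pYT P y t ≠ 0 := by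
  obtain ⟨hpos, h0, h1⟩ := ht
  intro h
  cases y
  · refine h1 ?_
    rw [postYT, div_eq_one_iff_eq hpos.ne', pT_eq_add, h, add_zero]
  · exact h0 (by rw [postYT, h, zero_div])

theorem condTS_le_Hval [Nonempty S] (P : S → Bool → T → ℝ) (t : T) (s : S) :
    condTS P t s ≤ Hval P t :=
  Finset.le_sup' (fun s => condTS P t s) (Finset.mem_univ s)

theorem Lval_le_condTS [Nonempty S] (P : S → Bool → T → ℝ) (t : T) (s : S) :
    Lval P t ≤ condTS P t s :=
  Finset.inf'_le (fun s => condTS P t s) (Finset.mem_univ s)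

theorem IsIP.Hval_le [Nonempty S] {ε : ℝ} {P : S → Bool → T → ℝ} (hP : IsIP ε P) (t : T) :
    Hval P t ≤ Real.exp ε * Lval P t := by
  obtain ⟨s₂, _, hs₂⟩ := Finset.exists_mem_eq_inf' (Finset.univ_nonempty (α := S))
    (fun s => condTS P t s)
  refine Finset.sup'_le _ _ fun s₁ _ => ?_
  rw [Lval, hs₂]
  exact hP s₁ s₂ t

theorem IsIP.condTS_pos {ε : ℝ} {P : S → Bool → T → ℝ} (hP : InfoStructure P) (hIP : IsIP ε P)
    {t : T} (ht : 0 < pT P t) (s : S) : 0 < condTS P t s := by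
  obtain ⟨s', _, hs'⟩ := Finset.exists_lt_of_sum_lt (s := Finset.univ) (f := fun _ : S => (0 : ℝ))
    (g := fun s => pST P s t) (by simpa [pST, pT] using ht)
  have hc : 0 < condTS P t s' := div_pos hs' (hP.2.2 s')
  exact pos_of_mul_pos_right (hc.trans_le (hIP s' s t)) (Real.exp_pos ε).le

/-- In a Blackwell optimal structure, no secret has all its privacy constraints at `t ∈ T̃` slack. -/
theorem BlackwellOptimal.not_slack [Nonempty S] {ε : ℝ} (hε : 0 ≤ ε) {P : S → Bool → T → ℝ}
    (hopt : BlackwellOptimal ε P) {t : T} (ht : inTildeT P t) (s₀ : S) :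
    ¬ (Hval P t < Real.exp ε * condTS P t s₀ ∧ condTS P t s₀ < Real.exp ε * Lval P t) := by
  rintro ⟨hH, hL⟩
  have h0 := hopt.1.1
  have hK : 1 ≤ Real.exp ε := Real.one_le_exp hε
  have hcpos := IsIP.condTS_pos hopt.1 hopt.2.1 ht.1
  have hc := hcpos s₀
  obtain ⟨η, hη, hη1, hηH, hηL⟩ : ∃ η : ℝ, 0 < η ∧ η ≤ 1 ∧
      η * (Real.exp ε * condTS P t s₀) ≤ Real.exp ε * condTS P t s₀ - Hval P t ∧
      η * condTS P t s₀ ≤ Real.exp ε * Lval P t - condTS P t s₀ := by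
    have hKc : 0 < Real.exp ε * condTS P t s₀ := by positivity
    refine ⟨min 1 (min ((Real.exp ε * condTS P t s₀ - Hval P t) / (Real.exp ε * condTS P t s₀))
      ((Real.exp ε * Lval P t - condTS P t s₀) / condTS P t s₀)), ?_, min_le_left _ _, ?_, ?_⟩
    · exact lt_min one_pos (lt_min (div_pos (sub_pos.2 hH) hKc) (div_pos (sub_pos.2 hL) hc))
    · exact (le_div_iff₀ hKc).1 ((min_le_right _ _).trans (min_le_left _ _))
    · exact (le_div_iff₀ hc).1 ((min_le_right _ _).trans (min_le_right _ _))
  let w : S → T → ℝ := fun s t' => if s = s₀ ∧ t' = t then η else 0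
  have hw : ∀ s t', 0 ≤ w s t' ∧ w s t' ≤ 1 := fun s t' => by
    dsimp only [w]
    split_ifs <;> constructor <;> linarith
  have hIPw : ∀ σ : ℝ, (σ = 1 ∨ σ = -1) → ∀ s₁ s₂ t', condTS P t' s₁ * (1 + σ * w s₁ t') ≤
      Real.exp ε * (condTS P t' s₂ * (1 + σ * w s₂ t')) := by
    intro σ hσ s₁ s₂ t'
    by_cases htt : t' = t
    · subst htt
      have hIP := hopt.2.1 s₁ s₂ t'
      have hs₁ := condTS_le_Hval P t' s₁
      have hs₂ := mul_le_mul_of_nonneg_left (Lval_le_condTS P t' s₂) (Real.exp_pos ε).le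
      have hηc : 0 ≤ η * condTS P t' s₀ := by positivity
      have hηKc : 0 ≤ η * (Real.exp ε * condTS P t' s₀) := by positivity
      by_cases e₁ : s₁ = s₀ <;> by_cases e₂ : s₂ = s₀
      · have hσw : 0 ≤ 1 + σ * w s₀ t' := by
          have := hw s₀ t'
          rcases hσ with rfl | rfl <;> linarith
        rw [e₁, e₂, ← mul_assoc]
        exact mul_le_mul_of_nonneg_right (hopt.2.1 s₀ s₀ t') hσw
      all_goals
        rcases hσ with rfl | rfl <;> simp only [w, e₁, e₂, and_true, if_true, if_false] <;>
          simp only [e₁, e₂] at * <;> nlinarith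
    · simpa [w, htt] using hopt.2.1 s₁ s₂ t'
  let A : S → Bool → T → ℝ := fun s y t' => P s y t' * (1 + w s t') / 2
  have hST : ∀ s t', pST A s t' / pS P s = condTS P t' s * (1 + 1 * w s t') / 2 := fun s t' => by
    simp only [condTS, pST_eq_add, A]
    ring
  have hST' : ∀ s t', (pST P s t' - pST A s t') / pS P s =
      condTS P t' s * (1 + -1 * w s t') / 2 := fun s t' => by
    simp only [condTS, pST_eq_add, A]
    ring
  have key := hopt.proportional_of_split A
    (fun s y t' => by
      have := (hw s t').1
      have := h0 s y t'
      positivity)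
    (fun s y t' => by
      have := mul_le_mul_of_nonneg_left (hw s t').2 (h0 s y t')
      simp only [A]
      linarith)
    (fun s₁ s₂ t' => by
      have := hIPw 1 (Or.inl rfl) s₁ s₂ t'
      rw [hST, hST]
      linarith)
    (fun s₁ s₂ t' => by
      have := hIPw (-1) (Or.inr rfl) s₁ s₂ t'
      rw [hST', hST']
      linarith) t
  have hYT : ∀ y, pYT A y t = pYT P y t / 2 + P s₀ y t * η / 2 := fun y => by
    have : ∀ s, A s y t = P s y t / 2 + if s = s₀ then P s y t * η / 2 else 0 := fun s => by
      by_cases h : s = s₀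
      · simp only [A, w, h, and_self, if_true]
        ring
      · simp [A, w, h]
    simp only [pYT, this, Finset.sum_add_distrib, Finset.sum_div, Finset.sum_ite_eq',
      Finset.mem_univ, if_true]
  rw [hYT, hYT] at key
  have key : P s₀ true t * pYT P false t = P s₀ false t * pYT P true t :=
    mul_left_cancel₀ hη.ne' (by linear_combination 2 * key)
  have hpos : pST P s₀ t ≠ 0 := fun h => hc.ne' (by rw [condTS, h, zero_div])
  rw [pST_eq_add] at hpos
  rcases _root_.mul_eq_zero.1 (hopt.mul_eq_zero ht.1 s₀) with h | h
  · rw [h, zero_mul, eq_comm] at key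
    have := (_root_.mul_eq_zero.1 key).resolve_right (ht.pYT_ne_zero true)
    exact hpos (by rw [h, this, add_zero])
  · rw [h, zero_mul] at key
    have := (_root_.mul_eq_zero.1 key).resolve_right (ht.pYT_ne_zero false)
    exact hpos (by rw [h, this, add_zero])

end Splitting

/-- in any ε-IP Blackwell optimal information structure the
privacy constraint binds on `T̃`: `H_t = e^ε·L_t` and every `P(T=t|S=s)` is
either `L_t` or `H_t`. -/
theorem statement1 {S T : Type} [Fintype S] [Fintype T] [Nonempty S]
    (ε : ℝ) (hε : 0 ≤ ε) (P : S → Bool → T → ℝ)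
    (hopt : BlackwellOptimal ε P) :
    ∀ t, inTildeT P t →
      Hval P t = Real.exp ε * Lval P t ∧
      ∀ s, condTS P t s = Lval P t ∨ condTS P t s = Hval P t := by
  intro t ht
  have hslack := hopt.not_slack hε ht
  have hHL := hopt.2.1.Hval_le t
  have hKL := fun s => mul_le_mul_of_nonneg_left (Lval_le_condTS P t s) (Real.exp_pos ε).le
  have heq : Hval P t = Real.exp ε * Lval P t := by
    by_contra hne
    have hlt := lt_of_le_of_ne hHL hne
    obtain ⟨s⟩ := ‹Nonempty S›
    exact hslack s ⟨hlt.trans_le (hKL s), (condTS_le_Hval P t s).trans_lt hlt⟩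
  refine ⟨heq, fun s => ?_⟩
  by_contra! hne
  have hL := lt_of_le_of_ne (Lval_le_condTS P t s) hne.1.symm
  have hH := lt_of_le_of_ne (condTS_le_Hval P t s) hne.2
  refine hslack s ⟨?_, heq ▸ hH⟩
  rw [heq]
  exact mul_lt_mul_of_pos_left hL (Real.exp_pos ε)

end IPPaper
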